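/- arXiv:1505.01181 — 10 statements merged into one kernel-verified Lean document; each statement's English description precedes it below -/
import Mathlib

section
/- Let α > 2, ε ∈ [0,1), σ² ≥ 0, M > 0, ρ > 0 and γ > 0. If 0 < K₁ < K₂ are such that M(1−ε²)² − B₂(M,K₂,ρ)γ > 0 (hence also M(1−ε²)² − B₂(M,K₁,ρ)γ > 0), then β*(M,K₁,ρ) < β*(M,K₂,ρ); i.e., the EE-optimal pilot reuse factor is strictly increasing in the number of users K. -/
/-- `B₁(M,K,ρ) = 4K/(α−2)² + (K + M(1−ε²))/(α−1) + 2(K + σ²/ρ)/(α−2)` -/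
noncomputable def B1 (α ε σ2 M K ρ : ℝ) : ℝ :=
  4*K/(α-2)^2 + (K + M*(1-ε^2))/(α-1) + 2*(K + σ2/ρ)/(α-2)

/-- `B₂(M,K,ρ) = (K + σ²/ρ + 2K/(α−2))(1 + σ²/ρ) + (1−ε²)ε²M` -/
noncomputable def B2 (α ε σ2 M K ρ : ℝ) : ℝ :=
  (K + σ2/ρ + 2*K/(α-2))*(1 + σ2/ρ) + (1-ε^2)*ε^2*M

/-- `β*(M,K,ρ) = B₁(M,K,ρ)γ / (M(1−ε²)² − B₂(M,K,ρ)γ)` -/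
noncomputable def betaStar (α ε σ2 γ M K ρ : ℝ) : ℝ :=
  B1 α ε σ2 M K ρ * γ / (M*(1-ε^2)^2 - B2 α ε σ2 M K ρ * γ)

/-- `B₁` is positive. -/
theorem B1_pos {α ε σ2 M K ρ : ℝ} (hα : 2 < α) (hε0 : 0 ≤ ε) (hε1 : ε < 1) (hσ : 0 ≤ σ2)
    (hM : 0 < M) (hρ : 0 < ρ) (hK : 0 < K) : 0 < B1 α ε σ2 M K ρ := by
  have h2 : 0 < α - 2 := by linarith
  have h1 : 0 < α - 1 := by linarith
  have hε : 0 < 1 - ε ^ 2 := by nlinarith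
  unfold B1
  positivity

/-- `B₁` is strictly increasing in the number of users. -/
theorem B1_strictMono {α : ℝ} (ε σ2 M ρ : ℝ) (hα : 2 < α) :
    StrictMono fun K => B1 α ε σ2 M K ρ := by
  intro K L hKL
  have h2 : 0 < α - 2 := by linarith
  have h1 : 0 < α - 1 := by linarith
  simp only [B1]
  gcongr

/-- `B₂` is strictly increasing in the number of users. -/
theorem B2_strictMono {α σ2 ρ : ℝ} (ε M : ℝ) (hα : 2 < α) (hσ : 0 ≤ σ2) (hρ : 0 < ρ) :
    StrictMono fun K => B2 α ε σ2 M K ρ := by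
  intro K L hKL
  have h2 : 0 < α - 2 := by linarith
  have hs : 0 < 1 + σ2 / ρ := by positivity
  simp only [B2]
  gcongr

/-- the EE-optimal pilot reuse factor is strictly increasing in the
number of users `K`. -/
theorem stmt_1 (α ε σ2 M ρ γ K1 K2 : ℝ)
    (hα : 2 < α) (hε0 : 0 ≤ ε) (hε1 : ε < 1) (hσ : 0 ≤ σ2)
    (hM : 0 < M) (hρ : 0 < ρ) (hγ : 0 < γ)
    (hK1 : 0 < K1) (hK12 : K1 < K2)
    (hpos2 : 0 < M*(1-ε^2)^2 - B2 α ε σ2 M K2 ρ * γ) :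
    0 < M*(1-ε^2)^2 - B2 α ε σ2 M K1 ρ * γ ∧
      betaStar α ε σ2 γ M K1 ρ < betaStar α ε σ2 γ M K2 ρ := by
  have hB1 := B1_strictMono ε σ2 M ρ hα hK12
  have hB2 := mul_lt_mul_of_pos_right (B2_strictMono ε M hα hσ hρ hK12) hγ
  have hB := B1_pos hα hε0 hε1 hσ hM hρ (hK1.trans hK12)
  simp only at hB1 hB2
  refine ⟨by linarith, ?_⟩
  unfold betaStar
  exact div_lt_div₀ (mul_lt_mul_of_pos_right hB1 hγ) (by linarith) (by positivity) hpos2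
end

section
/- Let α > 2, ε ∈ [0,1), σ² ≥ 0, K > 0, ρ > 0 and γ > 0 with ε²γ < 1−ε². If 0 < M₁ < M₂ and M₁(1−ε²)² − B₂(M₁,K,ρ)γ > 0 (which together with ε²γ < 1−ε² implies M₂(1−ε²)² − B₂(M₂,K,ρ)γ > 0), then β*(M₂,K,ρ) < β*(M₁,K,ρ); i.e., the EE-optimal pilot reuse factor is strictly decreasing in the number of antennas M. -/
/-- An affine-over-affine quotient `(a + b x) / (d x - c)` with nonnegative `b`, `c` and positive
`a`, `d` is strictly decreasing where its denominator is positive. -/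
theorem affine_div_affine_lt {a b c d x y : ℝ} (ha : 0 < a) (hb : 0 ≤ b) (hc : 0 ≤ c)
    (hd : 0 < d) (hxy : x < y) (hx : 0 < d * x - c) :
    (a + b * y) / (d * y - c) < (a + b * x) / (d * x - c) := by
  have hy : 0 < d * y - c := by linarith [mul_lt_mul_of_pos_left hxy hd]
  rw [div_lt_div_iff₀ hy hx]
  have h1 : 0 < a * d * (y - x) := mul_pos (mul_pos ha hd) (sub_pos.2 hxy)
  have h2 : 0 ≤ b * c * (y - x) := mul_nonneg (mul_nonneg hb hc) (sub_pos.2 hxy).le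
  linarith

/-- if `ε²γ < 1−ε²`, the EE-optimal pilot reuse factor is strictly
decreasing in the number of antennas `M`. -/
theorem stmt_3 (α ε σ2 K ρ γ M1 M2 : ℝ)
    (hα : 2 < α) (hε0 : 0 ≤ ε) (hε1 : ε < 1) (hσ : 0 ≤ σ2)
    (hK : 0 < K) (hρ : 0 < ρ) (hγ : 0 < γ)
    (hεγ : ε^2*γ < 1 - ε^2)
    (hM1 : 0 < M1) (hM12 : M1 < M2)
    (hpos1 : 0 < M1*(1-ε^2)^2 - B2 α ε σ2 M1 K ρ * γ) :
    0 < M2*(1-ε^2)^2 - B2 α ε σ2 M2 K ρ * γ ∧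
      betaStar α ε σ2 γ M2 K ρ < betaStar α ε σ2 γ M1 K ρ := by
  have hα2 : 0 < α - 2 := by linarith
  have hα1 : 0 < α - 1 := by linarith
  have hs : 0 ≤ σ2 / ρ := by positivity
  have hε : 0 < 1 - ε ^ 2 := by nlinarith
  have hd : 0 < (1 - ε ^ 2) * (1 - ε ^ 2 - ε ^ 2 * γ) := mul_pos hε (by linarith)
  have hc : 0 ≤ (K + σ2 / ρ + 2 * K / (α - 2)) * (1 + σ2 / ρ) * γ := by positivity
  have ha : 0 < (4 * K / (α - 2) ^ 2 + K / (α - 1) + 2 * (K + σ2 / ρ) / (α - 2)) * γ := by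
    positivity
  have hb : 0 ≤ (1 - ε ^ 2) / (α - 1) * γ := by positivity
  have hden (M : ℝ) : M * (1 - ε ^ 2) ^ 2 - B2 α ε σ2 M K ρ * γ =
      (1 - ε ^ 2) * (1 - ε ^ 2 - ε ^ 2 * γ) * M -
        (K + σ2 / ρ + 2 * K / (α - 2)) * (1 + σ2 / ρ) * γ := by
    unfold B2
    ring
  have hnum (M : ℝ) : B1 α ε σ2 M K ρ * γ =
      (4 * K / (α - 2) ^ 2 + K / (α - 1) + 2 * (K + σ2 / ρ) / (α - 2)) * γ +
        (1 - ε ^ 2) / (α - 1) * γ * M := by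
    unfold B1
    ring
  unfold betaStar
  rw [hden] at hpos1
  rw [hden, hden, hnum, hnum]
  exact ⟨by linarith [mul_lt_mul_of_pos_left hM12 hd],
    affine_div_affine_lt ha hb hc hd hM12 hpos1⟩
end

section
/- Let α > 2, ε ∈ [0,1), σ² ≥ 0, ρ > 0 and S > 0. For every M > 0, every K ≥ 1 and every pilot reuse factor β with 1 ≤ β and βK ≤ S, the SINR lower bound satisfies the strict inequality SINR̲(M,K,β) < S(α−1)(1−ε²) / (1 + ε²S(α−1)). (Hence the SINR constraint SINR̲ = γ is feasible only for targets γ below this value.) -/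
/-- The SINR lower bound `SINR̲(M,K,β)` from Proposition 1. -/
noncomputable def SINRlb (α ε σ2 ρ M K β : ℝ) : ℝ :=
  M*(1-ε^2)^2 /
    ((K + σ2/ρ)*(1 + 2/(β*(α-2)) + σ2/ρ) + (2*K/(α-2))*(1 + σ2/ρ)
      + (K/β)*(4/(α-2)^2 + 1/(α-1)) + M*(1-ε^2)*(1/(β*(α-1)) + ε^2))

/-- for every `M > 0`, `K ≥ 1` and pilot reuse factor `β` with
`1 ≤ β` and `βK ≤ S`, the SINR lower bound is strictly below
`S(α−1)(1−ε²)/(1 + ε²S(α−1))`. -/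
theorem stmt_4 (α ε σ2 ρ S : ℝ)
    (hα : 2 < α) (hε0 : 0 ≤ ε) (hε1 : ε < 1) (hσ : 0 ≤ σ2) (hρ : 0 < ρ) (hS : 0 < S) :
    ∀ M K β : ℝ, 0 < M → 1 ≤ K → 1 ≤ β → β*K ≤ S →
      SINRlb α ε σ2 ρ M K β < S*(α-1)*(1-ε^2) / (1 + ε^2*S*(α-1)) := by
  intro M K β hM hK hβ hβK
  have ha : 0 < α - 1 := by linarith
  have ha2 : 0 < α - 2 := by linarith
  have he : 0 < 1 - ε^2 := by nlinarith
  have hβ0 : 0 < β := by linarith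
  have hK0 : 0 < K := by linarith
  have hβS : β ≤ S := by nlinarith
  have hs : 0 ≤ σ2 / ρ := by positivity
  have hP : 0 < (K + σ2/ρ)*(1 + 2/(β*(α-2)) + σ2/ρ) + (2*K/(α-2))*(1 + σ2/ρ)
      + (K/β)*(4/(α-2)^2 + 1/(α-1)) := by positivity
  have hQ : 0 < M*(1-ε^2)*(1/(β*(α-1)) + ε^2) := by positivity
  have hceil : S*(α-1)*(1-ε^2) / (1 + ε^2*S*(α-1))
      = M*(1-ε^2)^2 / (M*(1-ε^2)*(1/(S*(α-1)) + ε^2)) := by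
    field_simp
  rw [SINRlb, hceil]
  have hmono : M*(1-ε^2)*(1/(S*(α-1)) + ε^2) ≤ M*(1-ε^2)*(1/(β*(α-1)) + ε^2) := by
    gcongr
  exact div_lt_div_of_pos_left (by positivity) (by positivity) (by linarith)
end

section
/- Let α > 2, ε ∈ [0,1), σ² ≥ 0, γ > 0, S > 0, M > 0, K > 0, ρ̃ > 0, ω > 0, η ∈ (0,1], A ≥ 0 and C₀, C₁, D₀, D₁ > 0. Then on any subset of λ > 0 on which M(1−ε²)² − B₂(M,K,λρ̃)γ > 0 and 1 ≤ Q(λ) ≤ S/K hold, the energy efficiency EE(λ) is monotonically non-decreasing in λ; consequently, over that set EE(λ) is maximized as λ → ∞, and the average transmit power ρ(λ)ω·Γ(α/2+1)/(πλ)^{α/2} = λρ̃·ω·Γ(α/2+1)/(πλ)^{α/2} tends to 0 as λ → ∞. -/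
open Real Filter

/-- `Q(λ) = B₁(M,K,λρ̃)γ/(M(1−ε²)² − B₂(M,K,λρ̃)γ)`, the EE-optimal pilot reuse factor. -/
noncomputable def Qfun (α ε σ2 γ M K ρt lam : ℝ) : ℝ :=
  B1 α ε σ2 M K (lam*ρt) * γ / (M*(1-ε^2)^2 - B2 α ε σ2 M K (lam*ρt) * γ)

/-- The energy efficiency `EE(λ)` of (23) with `ρ(λ) = λρ̃`. -/
noncomputable def EE (α ε σ2 γ S M K ρt ω η A C0 C1 D0 D1 lam : ℝ) : ℝ :=
  K*(1 - (K/S)*Qfun α ε σ2 γ M K ρt lam)*Real.logb 2 (1+γ) /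
    ((1 + 1/S - (K/S)*Qfun α ε σ2 γ M K ρt lam)*(K*(lam*ρt)*ω/η)
        * Real.Gamma (α/2+1) / (Real.pi*lam)^(α/2)
      + C0 + C1*K + D0*M + D1*M*K
      + A*K*(1 - (K/S)*Qfun α ε σ2 γ M K ρt lam)*Real.logb 2 (1+γ))

/-- `B₁` is non-negative for `α > 2` and positive parameters. -/
theorem B1_nonneg {α ε σ2 M K ρ : ℝ} (hα : 2 < α) (hε : ε ^ 2 ≤ 1) (hσ : 0 ≤ σ2) (hM : 0 ≤ M)
    (hK : 0 ≤ K) (hρ : 0 ≤ ρ) : 0 ≤ B1 α ε σ2 M K ρ := by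
  have h2 : 0 < α - 2 := by linarith
  have h1 : 0 < α - 1 := by linarith
  have he : 0 ≤ 1 - ε ^ 2 := by linarith
  unfold B1
  positivity

/-- `B₁` is non-increasing in the power-control coefficient. -/
theorem B1_anti {α ε σ2 M K ρ₁ ρ₂ : ℝ} (hα : 2 < α) (hσ : 0 ≤ σ2) (hρ₁ : 0 < ρ₁)
    (h : ρ₁ ≤ ρ₂) : B1 α ε σ2 M K ρ₂ ≤ B1 α ε σ2 M K ρ₁ := by
  have h2 : 0 < α - 2 := by linarith
  unfold B1
  gcongr

/-- `B₂` is non-increasing in the power-control coefficient. -/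
theorem B2_anti {α ε σ2 M K ρ₁ ρ₂ : ℝ} (hα : 2 < α) (hσ : 0 ≤ σ2) (hK : 0 ≤ K) (hρ₁ : 0 < ρ₁)
    (h : ρ₁ ≤ ρ₂) : B2 α ε σ2 M K ρ₂ ≤ B2 α ε σ2 M K ρ₁ := by
  have h2 : 0 < α - 2 := by linarith
  have hρ₂ : 0 < ρ₂ := hρ₁.trans_le h
  unfold B2
  gcongr

/-- The optimal reuse factor is non-increasing in the density, from any feasible density on. -/
theorem Qfun_anti {α ε σ2 γ M K ρt a b : ℝ} (hα : 2 < α) (hε : ε ^ 2 ≤ 1) (hσ : 0 ≤ σ2)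
    (hγ : 0 ≤ γ) (hM : 0 ≤ M) (hK : 0 ≤ K) (hρt : 0 < ρt) (ha : 0 < a) (hab : a ≤ b)
    (hfeas : 0 < M * (1 - ε ^ 2) ^ 2 - B2 α ε σ2 M K (a * ρt) * γ) :
    Qfun α ε σ2 γ M K ρt b ≤ Qfun α ε σ2 γ M K ρt a := by
  have hρ : 0 < a * ρt := mul_pos ha hρt
  have hle : a * ρt ≤ b * ρt := mul_le_mul_of_nonneg_right hab hρt.le
  unfold Qfun
  apply div_le_div₀
  · exact mul_nonneg (B1_nonneg hα hε hσ hM hK hρ.le) hγ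
  · exact mul_le_mul_of_nonneg_right (B1_anti hα hσ hρ hle) hγ
  · exact hfeas
  · exact sub_le_sub_left (mul_le_mul_of_nonneg_right (B2_anti hα hσ hK hρ hle) hγ) _

theorem div_pi_mul_rpow {lam : ℝ} (s : ℝ) (hlam : 0 < lam) :
    lam / (Real.pi * lam) ^ s = (Real.pi ^ s)⁻¹ * lam ^ (-(s - 1)) := by
  rw [Real.mul_rpow Real.pi_pos.le hlam.le, show -(s - 1) = 1 - s by ring,
    Real.rpow_sub hlam, Real.rpow_one]
  field_simp

theorem div_pi_mul_rpow_anti {s a b : ℝ} (hs : 1 ≤ s) (ha : 0 < a) (hab : a ≤ b) :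
    b / (Real.pi * b) ^ s ≤ a / (Real.pi * a) ^ s := by
  rw [div_pi_mul_rpow s ha, div_pi_mul_rpow s (ha.trans_le hab)]
  exact mul_le_mul_of_nonneg_left
    (Real.rpow_le_rpow_of_nonpos ha hab (by linarith)) (by positivity)

theorem tendsto_div_pi_mul_rpow_atTop {s : ℝ} (hs : 1 < s) :
    Tendsto (fun lam : ℝ => lam / (Real.pi * lam) ^ s) atTop (nhds 0) := by
  have h := (tendsto_rpow_neg_atTop (sub_pos.2 hs)).const_mul (Real.pi ^ s)⁻¹
  rw [mul_zero] at h
  refine h.congr' ?_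
  filter_upwards [eventually_gt_atTop 0] with lam hlam
  exact (div_pi_mul_rpow s hlam).symm

/-- A throughput-over-power ratio increases when the throughput factor `x` increases and the
transmit power `p` decreases. -/
theorem throughput_div_power_mono {K R A t c x y p q : ℝ} (hK : 0 ≤ K) (hR : 0 ≤ R) (hA : 0 ≤ A)
    (ht : 0 ≤ t) (hc : 0 < c) (hx : 0 ≤ x) (hxy : x ≤ y) (hq : 0 ≤ q) (hqp : q ≤ p) :
    K * x * R / ((x + t) * p + c + A * K * x * R) ≤
      K * y * R / ((y + t) * q + c + A * K * y * R) := by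
  have hy : 0 ≤ y := hx.trans hxy
  have hp : 0 ≤ p := hq.trans hqp
  rw [div_le_div_iff₀ (by positivity) (by positivity)]
  have h : x * ((y + t) * q + c) ≤ y * ((x + t) * p + c) := by
    have h₁ : x * y * q ≤ x * y * p := mul_le_mul_of_nonneg_left hqp (mul_nonneg hx hy)
    have h₂ : x * q * t ≤ y * p * t :=
      mul_le_mul_of_nonneg_right (mul_le_mul hxy hqp hq hy) ht
    have h₃ : x * c ≤ y * c := mul_le_mul_of_nonneg_right hxy hc.le
    linarith
  linarith [mul_le_mul_of_nonneg_left h (mul_nonneg hK hR)]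

/-- on the set of densities `λ > 0` where the SINR constraint is feasible
(`M(1−ε²)² − B₂(M,K,λρ̃)γ > 0` and `1 ≤ Q(λ) ≤ S/K`), the energy efficiency `EE(λ)` is
monotonically non-decreasing in `λ`, and the average transmit power
`λρ̃·ω·Γ(α/2+1)/(πλ)^{α/2}` tends to `0` as `λ → ∞`. -/
theorem stmt_7 (α ε σ2 γ S M K ρt ω η A C0 C1 D0 D1 : ℝ)
    (hα : 2 < α) (hε0 : 0 ≤ ε) (hε1 : ε < 1) (hσ : 0 ≤ σ2) (hγ : 0 < γ) (hS : 0 < S)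
    (hM : 0 < M) (hK : 0 < K) (hρt : 0 < ρt) (hω : 0 < ω) (hη0 : 0 < η) (hη1 : η ≤ 1)
    (hA : 0 ≤ A) (hC0 : 0 < C0) (hC1 : 0 < C1) (hD0 : 0 < D0) (hD1 : 0 < D1) :
    MonotoneOn (EE α ε σ2 γ S M K ρt ω η A C0 C1 D0 D1)
      {lam : ℝ | 0 < lam ∧ 0 < M*(1-ε^2)^2 - B2 α ε σ2 M K (lam*ρt) * γ ∧
        1 ≤ Qfun α ε σ2 γ M K ρt lam ∧ Qfun α ε σ2 γ M K ρt lam ≤ S/K} ∧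
    Tendsto (fun lam : ℝ => lam*ρt*ω*Real.Gamma (α/2+1)/(Real.pi*lam)^(α/2))
      atTop (nhds 0) := by
  have hε : ε ^ 2 ≤ 1 := pow_le_one₀ hε0 hε1.le
  have hΓ : 0 < Real.Gamma (α / 2 + 1) := Real.Gamma_pos_of_pos (by linarith)
  constructor
  · rintro a ⟨ha, hfeas, -, hQ⟩ b ⟨hb, -, -, -⟩ hab
    have hR : 0 ≤ Real.logb 2 (1 + γ) := Real.logb_nonneg one_lt_two (by linarith)
    have hQab := Qfun_anti hα hε hσ hγ.le hM.le hK.le hρt ha hab hfeas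
    have hx : 0 ≤ 1 - K / S * Qfun α ε σ2 γ M K ρt a := by
      have h := mul_le_mul_of_nonneg_left hQ (div_pos hK hS).le
      rw [div_mul_div_cancel₀ hS.ne', div_self hK.ne'] at h
      linarith
    have hxy : 1 - K / S * Qfun α ε σ2 γ M K ρt a ≤ 1 - K / S * Qfun α ε σ2 γ M K ρt b :=
      sub_le_sub_left (mul_le_mul_of_nonneg_left hQab (div_pos hK hS).le) _
    have hqp := mul_le_mul_of_nonneg_left
      (div_pi_mul_rpow_anti (s := α / 2) (by linarith) ha hab)
      (show 0 ≤ K * ρt * ω / η * Real.Gamma (α / 2 + 1) by positivity)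
    have key := throughput_div_power_mono (t := 1 / S)
      (c := C0 + C1 * K + D0 * M + D1 * M * K) hK.le hR hA
      (by positivity) (by positivity) hx hxy (by positivity) hqp
    change EE α ε σ2 γ S M K ρt ω η A C0 C1 D0 D1 a ≤ EE α ε σ2 γ S M K ρt ω η A C0 C1 D0 D1 b
    unfold EE
    convert key using 2 <;> ring
  · have h := (tendsto_div_pi_mul_rpow_atTop (s := α / 2) (by linarith)).const_mul
      (ρt * ω * Real.Gamma (α / 2 + 1))
    rw [mul_zero] at h
    refine h.congr fun lam => ?_
    ring
end

section
/- Let α > 2, ε ∈ [0,1), γ > 0, S > 0, c̄ > 0 with (1−ε²)(1−(1+γ)ε²)c̄ − (1+2/(α−2))γ > 0, C₀, C₁, D₀, D₁ > 0 and A ≥ 0, and assume G(c̄) > 0. Then 0 < K*(c̄) < 1/G(c̄), and K*(c̄) maximizes f over the interval (0, 1/G(c̄)]: for every K with 0 < K ≤ 1/G(c̄), f(K) ≤ f(K*(c̄)). -/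
/-- `G(c̄)` from Theorem 3. -/
noncomputable def Gfun (α ε γ S cbar : ℝ) : ℝ :=
  (1/S) * (4*γ/(α-2)^2 + γ/(α-1) + 2*γ/(α-2) + (γ*(1-ε^2)/(α-1))*cbar) /
    ((1-ε^2)*(1-(1+γ)*ε^2)*cbar - (1 + 2/(α-2))*γ)

/-- The objective `f(K)` of (30). -/
noncomputable def ffun (α ε γ S C0 C1 D0 D1 A cbar K : ℝ) : ℝ :=
  K*(1 - K*Gfun α ε γ S cbar)*Real.logb 2 (1+γ) /
    (C0 + (C1 + D0*cbar)*K + D1*cbar*K^2 + A*K*(1 - K*Gfun α ε γ S cbar)*Real.logb 2 (1+γ))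

/-- The EE-maximizing number of users `K*(c̄)` of (28). -/
noncomputable def Kstar (α ε γ S C0 C1 D0 D1 cbar : ℝ) : ℝ :=
  (Real.sqrt ((Gfun α ε γ S cbar * C0)^2 + C0*D1*cbar
      + C0*Gfun α ε γ S cbar*(C1 + D0*cbar)) - Gfun α ε γ S cbar * C0) /
    (D1*cbar + Gfun α ε γ S cbar*(C1 + D0*cbar))

/-- The larger root of `D x² + 2 b x = c`, written with the quadratic formula, is positive. -/
lemma quadratic_root_pos_and_eq {D b c : ℝ} (hD : 0 < D) (hc : 0 < c) :
    0 < (√(b ^ 2 + c * D) - b) / D ∧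
      D * ((√(b ^ 2 + c * D) - b) / D) ^ 2 + 2 * b * ((√(b ^ 2 + c * D) - b) / D) = c := by
  have hcD : 0 < c * D := mul_pos hc hD
  have hs : √(b ^ 2 + c * D) ^ 2 = b ^ 2 + c * D := Real.sq_sqrt (by positivity)
  have hlt : b < √(b ^ 2 + c * D) := Real.lt_sqrt_of_sq_lt (by linarith)
  generalize √(b ^ 2 + c * D) = s at hs hlt ⊢
  refine ⟨div_pos (sub_pos.2 hlt) hD, ?_⟩
  field_simp
  linear_combination hs

/-- The critical point `k` of the ratio of `K (1 - K g)` and `C + B K + E K²` maximizes it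
over the positive reals, in cross-multiplied form. -/
lemma cross_mul_le_of_critical {g B C E k K : ℝ} (hg : 0 < g) (hB : 0 < B) (hC : 0 < C)
    (hE : 0 < E) (hk : 0 < k) (hcrit : (E + g * B) * k ^ 2 + 2 * (g * C) * k = C) :
    K * (1 - K * g) * (C + B * k + E * k ^ 2) ≤ k * (1 - k * g) * (C + B * K + E * K ^ 2) := by
  have h : 0 ≤ (K - k) ^ 2 * (g * C + (g * B + E) * k) := by positivity
  linear_combination h - (K - k) * hcrit

/-- Adding a nonnegative multiple of the numerator to the denominator preserves the order of
two ratios. -/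
lemma mul_div_add_le_mul_div_add {n n' p p' r A : ℝ} (hn : 0 ≤ n) (hn' : 0 ≤ n') (hp : 0 < p)
    (hp' : 0 < p') (hr : 0 ≤ r) (hA : 0 ≤ A) (h : n * p' ≤ n' * p) :
    n * r / (p + A * n * r) ≤ n' * r / (p' + A * n' * r) := by
  rw [div_le_div_iff₀ (by positivity) (by positivity)]
  linear_combination r * h

/-- `K*(c̄)` lies in `(0, 1/G(c̄))` and maximizes `f` over `(0, 1/G(c̄)]`. -/
theorem stmt_9 (α ε γ S cbar C0 C1 D0 D1 A : ℝ)
    (hα : 2 < α) (hε0 : 0 ≤ ε) (hε1 : ε < 1) (hγ : 0 < γ) (hS : 0 < S)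
    (hcbar : 0 < cbar) (hfeas : 0 < (1-ε^2)*(1-(1+γ)*ε^2)*cbar - (1 + 2/(α-2))*γ)
    (hC0 : 0 < C0) (hC1 : 0 < C1) (hD0 : 0 < D0) (hD1 : 0 < D1) (hA : 0 ≤ A)
    (hG : 0 < Gfun α ε γ S cbar) :
    (0 < Kstar α ε γ S C0 C1 D0 D1 cbar ∧
      Kstar α ε γ S C0 C1 D0 D1 cbar < 1/Gfun α ε γ S cbar) ∧
    ∀ K : ℝ, 0 < K → K ≤ 1/Gfun α ε γ S cbar →
      ffun α ε γ S C0 C1 D0 D1 A cbar K ≤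
        ffun α ε γ S C0 C1 D0 D1 A cbar (Kstar α ε γ S C0 C1 D0 D1 cbar) := by
  unfold ffun Kstar
  set g := Gfun α ε γ S cbar
  have hB : 0 < C1 + D0 * cbar := by positivity
  have hE : 0 < D1 * cbar := by positivity
  have hR : 0 ≤ Real.logb 2 (1 + γ) := Real.logb_nonneg (by norm_num) (by linarith)
  have hrad : (g * C0) ^ 2 + C0 * D1 * cbar + C0 * g * (C1 + D0 * cbar) =
      (g * C0) ^ 2 + C0 * (D1 * cbar + g * (C1 + D0 * cbar)) := by ring
  obtain ⟨hk, hcrit⟩ := quadratic_root_pos_and_eq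
    (D := D1 * cbar + g * (C1 + D0 * cbar)) (b := g * C0) (by positivity) hC0
  rw [hrad]
  set k := (√((g * C0) ^ 2 + C0 * (D1 * cbar + g * (C1 + D0 * cbar))) - g * C0) /
    (D1 * cbar + g * (C1 + D0 * cbar))
  have hkg : k * g < 1 := by
    have h : 0 < (D1 * cbar + g * (C1 + D0 * cbar)) * k ^ 2 := by positivity
    by_contra! hge
    have := mul_le_mul_of_nonneg_left hge hC0.le
    linarith
  refine ⟨⟨hk, (lt_div_iff₀ hG).2 hkg⟩, fun K hK hKg => ?_⟩
  have hKg' : K * g ≤ 1 := (le_div_iff₀ hG).1 hKg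
  have key := mul_div_add_le_mul_div_add (mul_nonneg hK.le (sub_nonneg.2 hKg'))
    (mul_nonneg hk.le (sub_nonneg.2 hkg.le))
    (show 0 < C0 + (C1 + D0 * cbar) * K + D1 * cbar * K ^ 2 by positivity)
    (show 0 < C0 + (C1 + D0 * cbar) * k + D1 * cbar * k ^ 2 by positivity) hR hA
    (cross_mul_le_of_critical hG hB hC0 hE hk hcrit)
  simpa only [mul_assoc] using key
end

section
/- Let α > 2, ε ∈ [0,1), γ > 0, S > 0, c̄ > 0 with (1−ε²)(1−(1+γ)ε²)c̄ − (1+2/(α−2))γ > 0, C₀, C₁, D₀, D₁ > 0 and A ≥ 0, and assume G(c̄) > 0. Then f is quasiconcave on the interval [0, 1/G(c̄)] (i.e., for every level t, the superlevel set {K ∈ [0, 1/G(c̄)] : f(K) ≥ t} is convex). -/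
/-- If `N` is nonnegative and concave and `Q` is positive and convex, then `N / (Q + A * N)` is
quasiconcave for every `A ≥ 0`. -/
theorem ConcaveOn.quasiconcaveOn_div_add_mul {E : Type*} [AddCommGroup E] [Module ℝ E]
    {s : Set E} {N Q : E → ℝ} {A : ℝ} (hN : ConcaveOn ℝ s N) (hQ : ConvexOn ℝ s Q)
    (hN0 : ∀ x ∈ s, 0 ≤ N x) (hQ0 : ∀ x ∈ s, 0 < Q x) (hA : 0 ≤ A) :
    QuasiconcaveOn ℝ s (fun x => N x / (Q x + A * N x)) := by
  have hD : ∀ x ∈ s, 0 < Q x + A * N x := fun x hx =>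
    add_pos_of_pos_of_nonneg (hQ0 x hx) (mul_nonneg hA (hN0 x hx))
  have level_iff : ∀ t : ℝ, ∀ x ∈ s,
      t ≤ N x / (Q x + A * N x) ↔ t * Q x ≤ (1 - t * A) * N x := by
    intro t x hx
    rw [le_div_iff₀ (hD x hx)]
    constructor <;> intro h <;> linarith
  rintro t x ⟨hx, htx⟩ y ⟨hy, hty⟩ a b ha hb hab
  have hz := hN.1 hx hy ha hb hab
  refine ⟨hz, ?_⟩
  rcases le_or_gt t 0 with ht | ht
  · exact ht.trans (div_nonneg (hN0 _ hz) (hD _ hz).le)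
  rw [level_iff t x hx] at htx
  rw [level_iff t y hy] at hty
  rw [level_iff t _ hz]
  have hc : 0 < 1 - t * A :=
    pos_of_mul_pos_left ((mul_pos ht (hQ0 x hx)).trans_le htx) (hN0 x hx)
  have hNz := hN.2 hx hy ha hb hab
  have hQz := hQ.2 hx hy ha hb hab
  simp only [smul_eq_mul] at hNz hQz
  calc t * Q (a • x + b • y) ≤ t * (a * Q x + b * Q y) := by gcongr
    _ = a * (t * Q x) + b * (t * Q y) := by ring
    _ ≤ a * ((1 - t * A) * N x) + b * ((1 - t * A) * N y) := by gcongr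
    _ = (1 - t * A) * (a * N x + b * N y) := by ring
    _ ≤ (1 - t * A) * N (a • x + b • y) := by gcongr

/-- A real quadratic with nonnegative leading coefficient is convex on every convex set. -/
theorem convexOn_quadratic {s : Set ℝ} (hs : Convex ℝ s) {p : ℝ} (hp : 0 ≤ p) (q r : ℝ) :
    ConvexOn ℝ s (fun x => r + q * x + p * x ^ 2) := by
  refine ⟨hs, fun x _ y _ a b ha hb hab => ?_⟩
  obtain rfl : b = 1 - a := by linarith
  have h : 0 ≤ p * (a * (1 - a) * (x - y) ^ 2) := by positivity
  simp only [smul_eq_mul]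
  linarith

/-- `f` is quasiconcave on `[0, 1/G(c̄)]`: every superlevel set is convex. -/
theorem stmt_10 (α ε γ S cbar C0 C1 D0 D1 A : ℝ)
    (hα : 2 < α) (hε0 : 0 ≤ ε) (hε1 : ε < 1) (hγ : 0 < γ) (hS : 0 < S)
    (hcbar : 0 < cbar) (hfeas : 0 < (1-ε^2)*(1-(1+γ)*ε^2)*cbar - (1 + 2/(α-2))*γ)
    (hC0 : 0 < C0) (hC1 : 0 < C1) (hD0 : 0 < D0) (hD1 : 0 < D1) (hA : 0 ≤ A)
    (hG : 0 < Gfun α ε γ S cbar) :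
    ∀ t : ℝ, Convex ℝ {K : ℝ | K ∈ Set.Icc 0 (1/Gfun α ε γ S cbar) ∧
      t ≤ ffun α ε γ S C0 C1 D0 D1 A cbar K} := by
  have hR : 0 < Real.logb 2 (1 + γ) := Real.logb_pos (by norm_num) (by linarith)
  have hs : Convex ℝ (Set.Icc 0 (1 / Gfun α ε γ S cbar)) := convex_Icc _ _
  have hN : ConcaveOn ℝ (Set.Icc 0 (1 / Gfun α ε γ S cbar))
      (fun K => K * (1 - K * Gfun α ε γ S cbar) * Real.logb 2 (1 + γ)) := by
    have h := convexOn_quadratic hs (mul_pos hG hR).le (-Real.logb 2 (1 + γ)) 0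
    refine h.neg.congr fun K _ => ?_
    simp only [Pi.neg_apply]
    ring
  have hQ := convexOn_quadratic hs (mul_pos hD1 hcbar).le (C1 + D0 * cbar) C0
  have hN0 : ∀ K ∈ Set.Icc 0 (1 / Gfun α ε γ S cbar),
      0 ≤ K * (1 - K * Gfun α ε γ S cbar) * Real.logb 2 (1 + γ) := by
    rintro K ⟨hK0, hK1⟩
    rw [le_div_iff₀ hG] at hK1
    exact mul_nonneg (mul_nonneg hK0 (sub_nonneg.2 hK1)) hR.le
  have hQ0 : ∀ K ∈ Set.Icc 0 (1 / Gfun α ε γ S cbar),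
      0 < C0 + (C1 + D0 * cbar) * K + D1 * cbar * K ^ 2 := by
    rintro K ⟨hK0, -⟩
    positivity
  simpa only [QuasiconcaveOn, ffun, ← mul_assoc] using
    hN.quasiconcaveOn_div_add_mul hQ hN0 hQ0 hA
end

section
/- Let α > 2, ε ∈ [0,1), γ > 0, S > 0, K > 0, C₀, C₁, D₀, D₁ > 0 and A ≥ 0, with a₂ > a₀, and assume that the radicand a₁a₃ + a₁² + a₁a₂a₄/a₅ + a₀a₃a₄/a₅ − a₀a₁a₄/a₅ − a₀²a₃a₄/(a₂a₅) + a₀a₁a₃/a₂ + a₀a₃²/a₂ is nonnegative. Define c̄* = (a₁ + a₃ + √(a₁a₃ + a₁² + a₁a₂a₄/a₅ + a₀a₃a₄/a₅ − a₀a₁a₄/a₅ − a₀²a₃a₄/(a₂a₅) + a₀a₁a₃/a₂ + a₀a₃²/a₂)) / (a₂ − a₀), and assume a₂c̄* − a₃ > 0 and that (a₀c̄* + a₁)/(a₂c̄* − a₃) ≥ K/S. Then for every c̄ with a₂c̄ − a₃ > 0, (a₀c̄ + a₁)/(a₂c̄ − a₃) ≥ K/S, and a₄ + a₅c̄ + A·K(1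 − (a₀c̄+a₁)/(a₂c̄−a₃))·R > 0, one has g(c̄) ≤ g(c̄*). -/
/-- If `x` is a critical point of `(b * y - m) / P y` with `P` a quadratic of leading
coefficient `p ≥ 0`, and the numerator at `x` is nonnegative, then `x` is a global maximizer,
in cross-multiplied form. -/
theorem linear_mul_quadratic_le_of_critical {b m p r q x : ℝ} (hp : 0 ≤ p)
    (hn : 0 ≤ b * x - m)
    (hx : b * (p * x ^ 2 + r * x + q) = (b * x - m) * (2 * p * x + r)) (y : ℝ) :
    (b * y - m) * (p * x ^ 2 + r * x + q) ≤ (b * x - m) * (p * y ^ 2 + r * y + q) := by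
  have h : 0 ≤ (b * x - m) * p * (y - x) ^ 2 := by positivity
  linear_combination h + (y - x) * hx


/-- with `a₀,…,a₅` as in Theorem 4, the point
`c̄* = (a₁ + a₃ + √(radicand))/(a₂ − a₀)` of (31) maximizes
`g(c̄) = K(1 − (a₀c̄+a₁)/(a₂c̄−a₃))R / (a₄ + a₅c̄ + AK(1 − (a₀c̄+a₁)/(a₂c̄−a₃))R)`
over all feasible `c̄` (those with `a₂c̄ − a₃ > 0`, `(a₀c̄+a₁)/(a₂c̄−a₃) ≥ K/S` and
positive denominator), provided `c̄*` itself is feasible. -/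
theorem stmt_11 (α ε γ S K C0 C1 D0 D1 A : ℝ)
    (hα : 2 < α) (hε0 : 0 ≤ ε) (hε1 : ε < 1) (hγ : 0 < γ) (hS : 0 < S) (hK : 0 < K)
    (hC0 : 0 < C0) (hC1 : 0 < C1) (hD0 : 0 < D0) (hD1 : 0 < D1) (hA : 0 ≤ A)
    (R a0 a1 a2 a3 a4 a5 : ℝ)
    (hR : R = Real.logb 2 (1+γ))
    (ha0 : a0 = γ*K*(1-ε^2)/(S*(α-1)))
    (ha1 : a1 = (K/S)*(4*γ/(α-2)^2 + γ/(α-1) + 2*γ/(α-2)))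
    (ha2 : a2 = (1-ε^2)*(1-(1+γ)*ε^2))
    (ha3 : a3 = (1 + 2/(α-2))*γ)
    (ha4 : a4 = C0 + C1*K)
    (ha5 : a5 = D0*K + D1*K^2)
    (ha20 : a0 < a2)
    (hrad : 0 ≤ a1*a3 + a1^2 + a1*a2*a4/a5 + a0*a3*a4/a5 - a0*a1*a4/a5
      - a0^2*a3*a4/(a2*a5) + a0*a1*a3/a2 + a0*a3^2/a2)
    (g : ℝ → ℝ)
    (hg : ∀ c, g c = K*(1 - (a0*c + a1)/(a2*c - a3))*R /
      (a4 + a5*c + A*K*(1 - (a0*c + a1)/(a2*c - a3))*R))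
    (cstar : ℝ)
    (hcstar : cstar = (a1 + a3 + Real.sqrt (a1*a3 + a1^2 + a1*a2*a4/a5 + a0*a3*a4/a5
      - a0*a1*a4/a5 - a0^2*a3*a4/(a2*a5) + a0*a1*a3/a2 + a0*a3^2/a2)) / (a2 - a0))
    (hfeas1 : 0 < a2*cstar - a3)
    (hfeas2 : K/S ≤ (a0*cstar + a1)/(a2*cstar - a3)) :
    ∀ c : ℝ, 0 < a2*c - a3 → K/S ≤ (a0*c + a1)/(a2*c - a3) →
      0 < a4 + a5*c + A*K*(1 - (a0*c + a1)/(a2*c - a3))*R →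
      g c ≤ g cstar := by
  have hε : 0 < 1 - ε ^ 2 := by nlinarith
  have hα1 : 0 < α - 1 := by linarith
  have hα2 : 0 < α - 2 := by linarith
  have h0 : 0 < a0 := by rw [ha0]; positivity
  have h2 : 0 < a2 := h0.trans ha20
  have h3 : 0 < a3 := by rw [ha3]; positivity
  have h4 : 0 < a4 := by rw [ha4]; positivity
  have h5 : 0 < a5 := by rw [ha5]; positivity
  have hRpos : 0 < R := by
    rw [hR]
    exact Real.logb_pos (by norm_num) (by linarith)
  have hb : 0 < a2 - a0 := sub_pos.mpr ha20
  have hsq := Real.sq_sqrt hrad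
  have hs0 := Real.sqrt_nonneg (a1*a3 + a1^2 + a1*a2*a4/a5 + a0*a3*a4/a5
      - a0*a1*a4/a5 - a0^2*a3*a4/(a2*a5) + a0*a1*a3/a2 + a0*a3^2/a2)
  rw [eq_div_iff hb.ne'] at hcstar
  have hn : (a2 - a0) * cstar - (a1 + a3) = Real.sqrt (a1*a3 + a1^2 + a1*a2*a4/a5 + a0*a3*a4/a5
      - a0*a1*a4/a5 - a0^2*a3*a4/(a2*a5) + a0*a1*a3/a2 + a0*a3^2/a2) := by
    linear_combination hcstar
  rw [← hn] at hsq hs0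
  have hcrit : (a2 - a0) * (a2 * a5 * cstar ^ 2 + (a2 * a4 - a3 * a5) * cstar + -(a3 * a4))
      = ((a2 - a0) * cstar - (a1 + a3)) * (2 * (a2 * a5) * cstar + (a2 * a4 - a3 * a5)) := by
    have hb0 : a2 - a0 ≠ 0 := hb.ne'
    field_simp at hsq
    refine mul_left_cancel₀ hb0 ?_
    linear_combination -hsq
  have hfrac : ∀ y, 0 < a2 * y - a3 → 1 - (a0 * y + a1) / (a2 * y - a3)
      = ((a2 - a0) * y - (a1 + a3)) / (a2 * y - a3) := by
    intro y hy
    rw [eq_div_iff hy.ne', sub_mul, div_mul_cancel₀ _ hy.ne']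
    ring
  intro c hc _ hden
  have hcs : 0 < cstar := pos_of_mul_pos_right (by linarith : 0 < a2 * cstar) h2.le
  have key := linear_mul_quadratic_le_of_critical (by positivity) hs0 hcrit c
  have hcross : ((a2 - a0) * c - (a1 + a3)) / (a2 * c - a3) * (a4 + a5 * cstar)
      ≤ ((a2 - a0) * cstar - (a1 + a3)) / (a2 * cstar - a3) * (a4 + a5 * c) := by
    rw [div_mul_eq_mul_div, div_mul_eq_mul_div, div_le_div_iff₀ hc hfeas1]
    linear_combination key
  rw [hg, hg]
  rw [hfrac c hc] at hden ⊢
  rw [hfrac cstar hfeas1]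
  have hfs : 0 ≤ ((a2 - a0) * cstar - (a1 + a3)) / (a2 * cstar - a3) := by positivity
  rw [div_le_div_iff₀ hden (by positivity)]
  linear_combination K * R * hcross
end

section
/- Let α > 2, ε ∈ [0,1) with (1+γ)ε² < 1, γ > 0, S > 0, C₀, C₁, D₀, D₁ > 0. Then √c̄ · K*(c̄) converges, as c̄ → ∞, to √( C₀ / (D₁ + G∞·D₀) ), where G∞ = γ / (S(α−1)(1−(1+γ)ε²)). In particular, the EE-optimal number of users K*(c̄) decays proportionally to 1/√c̄ as the number of antennas per user c̄ grows large. -/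
open Filter

/-- A quotient of affine functions converges to the ratio of the leading coefficients. -/
theorem tendsto_affine_div_affine_atTop (a b p q : ℝ) (hp : p ≠ 0) :
    Tendsto (fun c : ℝ => (a + b * c) / (p * c - q)) atTop (nhds (b / p)) := by
  have hinv : Tendsto (fun c : ℝ => c⁻¹) atTop (nhds 0) := tendsto_inv_atTop_zero
  have hlim : Tendsto (fun c : ℝ => (a * c⁻¹ + b) / (p - q * c⁻¹)) atTop
      (nhds ((a * 0 + b) / (p - q * 0))) :=
    ((hinv.const_mul a).add_const b).div ((hinv.const_mul q).const_sub p) (by simpa using hp)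
  simp only [mul_zero, zero_add, sub_zero] at hlim
  refine hlim.congr' ?_
  filter_upwards [eventually_gt_atTop 0] with c hc
  rw [← mul_div_mul_right _ _ hc.ne']
  congr 1 <;> field_simp

theorem tendsto_Gfun (α ε γ S : ℝ) (hα : 2 < α) (hε0 : 0 ≤ ε) (hε1 : ε < 1)
    (hεγ : (1+γ)*ε^2 < 1) (hS : 0 < S) :
    Tendsto (Gfun α ε γ S) atTop (nhds (γ/(S*(α-1)*(1-(1+γ)*ε^2)))) := by
  have hε : 1 - ε^2 ≠ 0 := by nlinarith
  have hδ : 1 - (1+γ)*ε^2 ≠ 0 := by linarith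
  have hα1 : α - 1 ≠ 0 := by linarith
  have h := (tendsto_affine_div_affine_atTop (4*γ/(α-2)^2 + γ/(α-1) + 2*γ/(α-2))
    (γ*(1-ε^2)/(α-1)) ((1-ε^2)*(1-(1+γ)*ε^2)) ((1 + 2/(α-2))*γ)
    (mul_ne_zero hε hδ)).const_mul (1/S)
  convert h using 1
  · funext c
    rw [Gfun, mul_div_assoc]
  · congr 1
    generalize 1 - (1+γ)*ε^2 = δ at *
    field_simp

/-- If the coefficient `G` converges to `g`, the positive root of the quadratic for the optimal
number of users, scaled by `√c`, converges. -/
theorem tendsto_sqrt_mul_quadratic_root {G : ℝ → ℝ} {g C0 C1 D0 D1 : ℝ}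
    (hG : Tendsto G atTop (nhds g)) (hpos : 0 < D1 + g * D0) :
    Tendsto (fun c : ℝ => √c * ((√((G c * C0)^2 + C0*D1*c + C0*G c*(C1 + D0*c)) - G c * C0) /
      (D1*c + G c*(C1 + D0*c)))) atTop (nhds (√(C0 / (D1 + g * D0)))) := by
  have hinv : Tendsto (fun c : ℝ => c⁻¹) atTop (nhds 0) := tendsto_inv_atTop_zero
  have hsqrt : Tendsto (fun c : ℝ => (√c)⁻¹) atTop (nhds 0) :=
    tendsto_inv_atTop_zero.comp Real.tendsto_sqrt_atTop
  have hden : Tendsto (fun c : ℝ => D1 + G c * (C1 * c⁻¹ + D0)) atTop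
      (nhds (D1 + g * (C1 * 0 + D0))) :=
    (hG.mul ((hinv.const_mul C1).add_const D0)).const_add D1
  have hlim := ((((((hG.mul_const C0).pow 2).mul hinv).add (hden.const_mul C0)).sqrt).sub
    ((hG.mul_const C0).mul hsqrt)).div hden (by simpa using hpos.ne')
  have hval : √(C0 / (D1 + g * D0)) = √(C0 * (D1 + g * D0)) / (D1 + g * D0) := by
    rw [Real.sqrt_mul' _ hpos.le, Real.sqrt_div' _ hpos.le, mul_div_assoc,
      Real.sqrt_div_self', mul_one_div]
  simp only [mul_zero, zero_add, sub_zero, ← hval] at hlim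
  refine hlim.congr' ?_
  filter_upwards [eventually_gt_atTop 0] with c hc
  have hc' : √c ≠ 0 := (Real.sqrt_pos.2 hc).ne'
  have hrad : (G c * C0)^2 + C0*D1*c + C0*G c*(C1 + D0*c) =
      ((G c * C0)^2 * c⁻¹ + C0 * (D1 + G c * (C1 * c⁻¹ + D0))) * c := by
    field_simp
    ring
  have hden_eq : D1*c + G c*(C1 + D0*c) = (D1 + G c * (C1 * c⁻¹ + D0)) * c := by
    field_simp
  rw [Pi.div_apply, hrad, Real.sqrt_mul' _ hc.le, hden_eq, ← mul_div_assoc, ← mul_div_mul_right _ _ hc.ne']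
  congr 1
  generalize √((G c * C0)^2 * c⁻¹ + C0 * (D1 + G c * (C1 * c⁻¹ + D0))) = r
  field_simp
  rw [Real.sq_sqrt hc.le]
  ring

/-- with `G∞ = γ/(S(α−1)(1−(1+γ)ε²))`, the quantity `√c̄ · K*(c̄)`
converges, as `c̄ → ∞`, to `√(C₀/(D₁ + G∞D₀))`; i.e. `K*(c̄)` decays like `1/√c̄`. -/
theorem stmt_14 (α ε γ S C0 C1 D0 D1 : ℝ)
    (hα : 2 < α) (hε0 : 0 ≤ ε) (hε1 : ε < 1) (hεγ : (1+γ)*ε^2 < 1) (hγ : 0 < γ)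
    (hS : 0 < S) (hC0 : 0 < C0) (hC1 : 0 < C1) (hD0 : 0 < D0) (hD1 : 0 < D1) :
    Tendsto (fun cbar : ℝ => Real.sqrt cbar * Kstar α ε γ S C0 C1 D0 D1 cbar) atTop
      (nhds (Real.sqrt (C0 / (D1 + (γ/(S*(α-1)*(1-(1+γ)*ε^2)))*D0)))) := by
  have hg : 0 < γ/(S*(α-1)*(1-(1+γ)*ε^2)) :=
    div_pos hγ (mul_pos (mul_pos hS (by linarith)) (by linarith))
  exact tendsto_sqrt_mul_quadratic_root (tendsto_Gfun α ε γ S hα hε0 hε1 hεγ hS) (by positivity)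
end

section
/- Fix G > 0, c̄ > 0 and C₁, D₀, D₁ > 0, and regard K* as a function of C₀, namely K*(C₀) = (√((GC₀)² + C₀D₁c̄ + C₀G(C₁+D₀c̄)) − GC₀)/(D₁c̄ + G(C₁+D₀c̄)). Then K* is strictly increasing on C₀ ∈ (0,∞): the EE-optimal number of users grows with the static power consumption C₀. -/
/-- For `G, B > 0`, the function `t ↦ √((G t)² + B t) - G t` is strictly increasing on `(0, ∞)`. -/
theorem sqrt_sq_add_mul_sub_lt {G B x y : ℝ} (hG : 0 < G) (hB : 0 < B) (hx : 0 < x)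
    (hxy : x < y) :
    Real.sqrt ((G*x)^2 + B*x) - G*x < Real.sqrt ((G*y)^2 + B*y) - G*y := by
  have hs := Real.sq_sqrt (show 0 ≤ (G*x)^2 + B*x by positivity)
  have hs0 := Real.sqrt_nonneg ((G*x)^2 + B*x)
  set s := Real.sqrt ((G*x)^2 + B*x)
  have hd : 0 < y - x := sub_pos.2 hxy
  have key : 2*G*s < 2*G^2*x + B := by
    refine lt_of_pow_lt_pow_left₀ 2 (by positivity) ?_
    have hsq : (2*G*s)^2 = 4*G^2*((G*x)^2 + B*x) := by rw [← hs]; ring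
    nlinarith [sq_pos_of_pos hB]
  suffices s + G*(y - x) < Real.sqrt ((G*y)^2 + B*y) by linarith
  refine (Real.lt_sqrt (by positivity)).2 ?_
  nlinarith [mul_lt_mul_of_pos_left key hd]

/-- the EE-optimal number of users
`K*(C₀) = (√((GC₀)² + C₀D₁c̄ + C₀G(C₁+D₀c̄)) − GC₀)/(D₁c̄ + G(C₁+D₀c̄))`
is strictly increasing in the static power consumption `C₀ ∈ (0,∞)`. -/
theorem stmt_15 (G cbar C1 D0 D1 : ℝ)
    (hG : 0 < G) (hcbar : 0 < cbar) (hC1 : 0 < C1) (hD0 : 0 < D0) (hD1 : 0 < D1) :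
    StrictMonoOn (fun C0 : ℝ =>
        (Real.sqrt ((G*C0)^2 + C0*D1*cbar + C0*G*(C1 + D0*cbar)) - G*C0) /
          (D1*cbar + G*(C1 + D0*cbar)))
      (Set.Ioi (0:ℝ)) := by
  intro x hx y _ hxy
  have hx : 0 < x := hx
  have hB : 0 < D1*cbar + G*(C1 + D0*cbar) := by positivity
  have e : ∀ t : ℝ, (G*t)^2 + t*D1*cbar + t*G*(C1 + D0*cbar) =
      (G*t)^2 + (D1*cbar + G*(C1 + D0*cbar))*t := fun t => by ring
  simp only [e]
  exact div_lt_div_of_pos_right (sqrt_sq_add_mul_sub_lt hG hB hx hxy) hB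
end

section
/- Let λ > 0 and s > 2. Then lim_{r→∞} πλ(r² − 1/(πλ)) · ∫₀^r tˢ · (2/(r²−t²)) · ((t^{2−s} − r^{2−s})/(s−2)) · 2πλ t e^{−πλt²} dt = 2/(s−2). (Taking s = κα with κ ∈ {1,2} and pathloss exponent α, this computes the limiting expected relative interference Σ_j (d_j/D_j)^{κα} over a Poisson field of base stations in a disc of radius r as r → ∞.) -/
open MeasureTheory Real Filter

lemma one_sub_rpow_sub_two_le {u s : ℝ} (hu : 0 < u) (hu1 : u < 1) (hs : 2 < s) :
    1 - u ^ (s - 2) ≤ s / 2 * (1 - u ^ 2) := by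
  have h1 : u ^ s ≤ u ^ (s - 2) :=
    Real.rpow_le_rpow_of_exponent_ge hu hu1.le (by linarith)
  have h2 : 1 + s / 2 * (u ^ 2 - 1) ≤ (1 + (u ^ 2 - 1)) ^ (s / 2) :=
    one_add_mul_self_le_rpow_one_add (by nlinarith [sq_nonneg u]) (by linarith)
  have h3 : (1 + (u ^ 2 - 1)) ^ (s / 2) = u ^ s := by
    rw [add_sub_cancel, ← Real.rpow_natCast, ← Real.rpow_mul hu.le]
    congr 1
    push_cast
    ring
  linarith

lemma rpow_mul_annulus_average_eq {t r : ℝ} (ht : 0 < t) (hr : 0 < r) (s : ℝ) :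
    t ^ s * (2 / (r ^ 2 - t ^ 2)) * ((t ^ (2 - s) - r ^ (2 - s)) / (s - 2)) =
      2 * t ^ 2 / (s - 2) * (1 - (t / r) ^ (s - 2)) / (1 - (t / r) ^ 2) / r ^ 2 := by
  have h1 : t ^ s * t ^ (2 - s) = t ^ 2 := by
    rw [← Real.rpow_add ht, ← Real.rpow_natCast]
    congr 1
    push_cast
    ring
  have h2 : t ^ s * r ^ (2 - s) = t ^ 2 * (t / r) ^ (s - 2) := by
    rw [Real.div_rpow ht.le hr.le, ← h1, show s - 2 = -(2 - s) by ring, Real.rpow_neg ht.le,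
      Real.rpow_neg hr.le]
    have := (Real.rpow_pos_of_pos ht (2 - s)).ne'
    have := (Real.rpow_pos_of_pos hr (2 - s)).ne'
    field_simp
  have h3 : r ^ 2 - t ^ 2 = r ^ 2 * (1 - (t / r) ^ 2) := by
    field_simp
  calc _ = 2 * (t ^ s * t ^ (2 - s) - t ^ s * r ^ (2 - s)) / (s - 2) / (r ^ 2 - t ^ 2) := by ring
    _ = 2 * t ^ 2 / (s - 2) * (1 - (t / r) ^ (s - 2)) / (r ^ 2 - t ^ 2) := by
      rw [h1, h2]; ring
    _ = _ := by rw [h3, mul_comm (r ^ 2), div_mul_eq_div_div]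

lemma integrableOn_cube_mul_exp_neg_mul_sq {a : ℝ} (ha : 0 < a) :
    IntegrableOn (fun t : ℝ => t ^ 3 * Real.exp (-(a * t ^ 2))) (Set.Ioi 0) := by
  have h := (integrable_rpow_mul_exp_neg_mul_sq ha (s := 3) (by norm_num)).integrableOn
    (s := Set.Ioi 0)
  refine h.congr_fun (fun t _ => ?_) measurableSet_Ioi
  norm_num

lemma integral_cube_mul_exp_neg_mul_sq {a : ℝ} (ha : 0 < a) :
    ∫ t in Set.Ioi (0 : ℝ), t ^ 3 * Real.exp (-(a * t ^ 2)) = 1 / (2 * a ^ 2) := by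
  have h := integral_rpow_mul_exp_neg_mul_rpow (p := 2) (q := 3) (b := a) (by norm_num)
    (by norm_num) ha
  have hG : Real.Gamma 2 = 1 := by simp
  have he : a ^ (-(2 : ℝ)) = 1 / a ^ 2 := by
    rw [Real.rpow_neg ha.le, Real.rpow_two, one_div]
  norm_num [hG, he] at h
  rw [h]
  field_simp

/-- for `λ > 0` and `s > 2`,
`lim_{r→∞} πλ(r² − 1/(πλ)) ∫₀^r tˢ (2/(r²−t²)) ((t^{2−s} − r^{2−s})/(s−2)) 2πλ t e^{−πλt²} dt
 = 2/(s−2)`,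
the limiting expected relative interference over a Poisson field of base stations. -/
theorem stmt_18 (lam s : ℝ) (hlam : 0 < lam) (hs : 2 < s) :
    Tendsto (fun r : ℝ =>
        π * lam * (r^2 - 1/(π * lam)) *
          ∫ t in Set.Ioo (0:ℝ) r,
            t ^ s * (2/(r^2 - t^2)) * ((t ^ (2 - s) - r ^ (2 - s))/(s - 2)) *
              (2 * π * lam * t * Real.exp (-(π * lam * t^2))))
      atTop (nhds (2/(s - 2))) := by
  obtain ⟨a, ha_def⟩ : ∃ a, a = π * lam := ⟨_, rfl⟩
  have ha : 0 < a := ha_def ▸ mul_pos Real.pi_pos hlam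
  simp only [mul_assoc 2 π lam, ← ha_def]
  have hs2 : 0 < s - 2 := by linarith
  let g : ℝ → ℝ := fun t => t ^ 3 * Real.exp (-(a * t ^ 2))
  let G : ℝ → ℝ → ℝ := fun r t =>
    (1 - (t / r) ^ (s - 2)) / (1 - (t / r) ^ 2) * (4 * a / (s - 2) * g t)
  have hprefactor : Tendsto (fun r : ℝ => a * (r ^ 2 - 1 / a) / r ^ 2) atTop (nhds a) := by
    have h : Tendsto (fun r : ℝ => a - (r ^ 2)⁻¹) atTop (nhds (a - 0)) :=
      tendsto_const_nhds.sub (tendsto_inv_atTop_zero.comp (tendsto_pow_atTop two_ne_zero))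
    rw [sub_zero] at h
    refine h.congr' ?_
    filter_upwards [eventually_gt_atTop 0] with r hr
    field_simp
  have hlim : Tendsto (fun r : ℝ => ∫ t in Set.Ioi (0 : ℝ), (Set.Iio r).indicator (G r) t) atTop
      (nhds (∫ t in Set.Ioi (0 : ℝ), 4 * a / (s - 2) * g t)) := by
    refine tendsto_integral_filter_of_dominated_convergence
      (fun t => s / 2 * (4 * a / (s - 2) * g t)) ?_ ?_ ?_ ?_
    · refine Eventually.of_forall fun r => ?_
      refine (Measurable.indicator ?_ measurableSet_Iio).aestronglyMeasurable
      fun_prop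
    · filter_upwards [eventually_gt_atTop 0] with r hr
      filter_upwards [ae_restrict_mem measurableSet_Ioi] with t ht
      have ht : 0 < t := ht
      have hg : 0 ≤ 4 * a / (s - 2) * g t := by positivity
      by_cases htr : t < r
      · have hu : 0 < t / r := by positivity
        have hu1 : t / r < 1 := (div_lt_one hr).2 htr
        have hd : 0 < 1 - (t / r) ^ 2 := by nlinarith
        have hn : 0 ≤ 1 - (t / r) ^ (s - 2) :=
          sub_nonneg.2 (Real.rpow_le_one hu.le hu1.le hs2.le)
        rw [Set.indicator_of_mem (Set.mem_Iio.2 htr), Real.norm_of_nonneg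
          (mul_nonneg (div_nonneg hn hd.le) hg)]
        refine mul_le_mul_of_nonneg_right ?_ hg
        exact (div_le_iff₀ hd).2 (one_sub_rpow_sub_two_le hu hu1 hs)
      · rw [Set.indicator_of_notMem (by simpa using htr), norm_zero]
        positivity
    · exact ((integrableOn_cube_mul_exp_neg_mul_sq ha).const_mul _).const_mul _
    · refine Eventually.of_forall fun t => ?_
      have hu : Tendsto (fun r : ℝ => t / r) atTop (nhds 0) :=
        tendsto_const_nhds.div_atTop tendsto_id
      have hp := hu.rpow_const (p := s - 2) (Or.inr hs2.le)
      rw [Real.zero_rpow hs2.ne'] at hp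
      have h : Tendsto (fun r => G r t) atTop
          (nhds ((1 - 0) / (1 - 0 ^ 2) * (4 * a / (s - 2) * g t))) :=
        ((hp.const_sub 1).div ((hu.pow 2).const_sub 1) (by norm_num)).mul_const _
      norm_num only [one_mul] at h
      refine h.congr' ?_
      filter_upwards [eventually_gt_atTop t] with r hr
      rw [Set.indicator_of_mem (Set.mem_Iio.2 hr)]
  have hval : a * ∫ t in Set.Ioi (0 : ℝ), 4 * a / (s - 2) * g t = 2 / (s - 2) := by
    rw [integral_const_mul, integral_cube_mul_exp_neg_mul_sq ha]
    field_simp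
    norm_num
  rw [← hval]
  refine (hprefactor.mul hlim).congr' ?_
  filter_upwards [eventually_gt_atTop 0] with r hr
  rw [setIntegral_indicator measurableSet_Iio, Set.Ioi_inter_Iio, div_mul_eq_mul_div,
    mul_div_assoc, ← integral_div]
  congr 1
  refine setIntegral_congr_fun measurableSet_Ioo fun t ht => ?_
  simp only [G, g]
  rw [rpow_mul_annulus_average_eq ht.1 hr]
  ring
end
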